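/- (Van Wijngaarden condensation transformation.) Let a : ℕ → ℝ be a strictly decreasing sequence of positive terms (a(k) > a(k+1) > 0 for all k) with ∑_{k=0}^∞ a(k) convergent. For j ∈ ℕ define the condensed series A_j = ∑_{k=0}^∞ 2^k · a(2^k·(j+1) − 1). Then: (i) for every j the series defining A_j converges (the sequence k ↦ 2^k·a(2^k(j+1)−1) is summable); (ii) the transformed alternating series converges to the original sum, i.e. the partial sums ∑_{j=0}^{N−1} (−1)^j A_j tend, as N → ∞, to ∑_{k=0}^∞ a(k). -/

import Mathlib

open Finset in
/-- One block of the condensed series is bounded by a block of the original series. -/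
theorem vw_block (a : ℕ → ℝ) (ha : Antitone a) (k j : ℕ) :
    (2 : ℝ) ^ k * a (2 ^ k * (j + 1) - 1) ≤
      ∑ i ∈ Ico (2 ^ k * j) (2 ^ k * (j + 1)), a i := by
  have h := Finset.card_nsmul_le_sum (Ico (2 ^ k * j) (2 ^ k * (j + 1))) a
    (a (2 ^ k * (j + 1) - 1)) (by
      intro i hi
      rw [Finset.mem_Ico] at hi
      exact ha (by omega))
  have hc : 2 ^ k * (j + 1) - 2 ^ k * j = 2 ^ k := by
    rw [Nat.mul_succ, Nat.add_sub_cancel_left]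
  rw [Nat.card_Ico, hc, nsmul_eq_mul] at h
  simpa using h

open Finset in
theorem vw_sum_block (a : ℕ → ℝ) (ha : Antitone a) (k M n : ℕ) :
    ∑ j ∈ Ico M (M + n), (2 : ℝ) ^ k * a (2 ^ k * (j + 1) - 1) ≤
      ∑ i ∈ Ico (2 ^ k * M) (2 ^ k * (M + n)), a i := by
  induction n with
  | zero => simp
  | succ n ih =>
    rw [← add_assoc, Finset.sum_Ico_succ_top (by omega),
      ← Finset.sum_Ico_consecutive a (n := 2 ^ k * (M + n))
        (Nat.mul_le_mul_left _ (by omega)) (Nat.mul_le_mul_left _ (by omega))]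
    exact add_le_add ih (vw_block a ha k _)

open Finset in
theorem vw_double (a : ℕ → ℝ) (ha : Antitone a) (M K : ℕ) :
    ∑ k ∈ range K, ∑ j ∈ Ico M (2 * M), (2 : ℝ) ^ k * a (2 ^ k * (j + 1) - 1) ≤
      ∑ i ∈ Ico M (2 ^ K * M), a i := by
  induction K with
  | zero => simp
  | succ K ih =>
    have h1 : 1 ≤ 2 ^ K := Nat.one_le_two_pow
    rw [Finset.sum_range_succ, ← Finset.sum_Ico_consecutive a (n := 2 ^ K * M)
        (by nlinarith) (Nat.mul_le_mul_right _ (by rw [pow_succ]; omega))]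
    refine add_le_add ih ?_
    have h := vw_sum_block a ha K M M
    have e : 2 ^ (K + 1) * M = 2 ^ K * (M + M) := by ring
    rw [e, two_mul]
    exact h

open Finset in
theorem vw_tail (a : ℕ → ℝ) (ha : Antitone a) (hpos : ∀ k, 0 < a k) (hsum : Summable a)
    (M K : ℕ) :
    ∑ k ∈ range K, ∑ j ∈ Ico M (2 * M), (2 : ℝ) ^ k * a (2 ^ k * (j + 1) - 1) ≤
      ∑' i, a (i + M) := by
  refine (vw_double a ha M K).trans ?_
  rw [Finset.sum_Ico_eq_sum_range]
  simp_rw [add_comm M]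
  exact ((summable_nat_add_iff M).2 hsum).sum_le_tsum _ (fun i _ => (hpos _).le)

theorem vw_shift (a : ℕ → ℝ) (j k : ℕ) :
    (2 : ℝ) ^ (k + 1) * a (2 ^ (k + 1) * (j + 1) - 1) =
      2 * ((2 : ℝ) ^ k * a (2 ^ k * ((2 * j + 1) + 1) - 1)) := by
  have e : 2 ^ (k + 1) * (j + 1) = 2 ^ k * ((2 * j + 1) + 1) := by ring
  rw [e]; ring

open Finset in
theorem vw_summable (a : ℕ → ℝ) (ha : Antitone a) (hpos : ∀ k, 0 < a k) (hsum : Summable a)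
    (j : ℕ) : Summable fun k : ℕ => (2 : ℝ) ^ k * a (2 ^ k * (j + 1) - 1) := by
  have hnn : ∀ j k : ℕ, 0 ≤ (2 : ℝ) ^ k * a (2 ^ k * (j + 1) - 1) := fun j k =>
    mul_nonneg (by positivity) (hpos _).le
  have key : ∀ j, 1 ≤ j → Summable fun k : ℕ => (2 : ℝ) ^ k * a (2 ^ k * (j + 1) - 1) := by
    intro j hj
    refine summable_of_sum_range_le (c := ∑' i, a (i + j)) (hnn j) fun K => ?_
    refine le_trans (Finset.sum_le_sum fun k _ => ?_) (vw_tail a ha hpos hsum j K)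
    exact Finset.single_le_sum (f := fun j => (2 : ℝ) ^ k * a (2 ^ k * (j + 1) - 1))
      (fun i _ => hnn i k) (Finset.mem_Ico.2 ⟨le_rfl, by omega⟩)
  rw [← summable_nat_add_iff 1]
  simp_rw [vw_shift]
  exact (key (2 * j + 1) (by omega)).mul_left 2

/-- **Van Wijngaarden condensation transformation**: for a strictly decreasing
positive summable sequence `a`, each condensed series
`A_j = ∑_k 2^k a(2^k(j+1) − 1)` converges, and the alternating series
`∑_j (−1)^j A_j` converges to the sum of the original series. -/
theorem van_wijngaarden_condensation
    (a : ℕ → ℝ)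
    (hpos : ∀ k, 0 < a k)
    (hdec : ∀ k, a (k + 1) < a k)
    (hsum : Summable a) :
    (∀ j : ℕ, Summable fun k : ℕ => (2 : ℝ) ^ k * a (2 ^ k * (j + 1) - 1)) ∧
    Filter.Tendsto
      (fun N : ℕ => ∑ j ∈ Finset.range N,
        (-1 : ℝ) ^ j * ∑' k : ℕ, (2 : ℝ) ^ k * a (2 ^ k * (j + 1) - 1))
      Filter.atTop (nhds (∑' k : ℕ, a k)) := by
  have ha : Antitone a := antitone_nat_of_succ_le fun k => (hdec k).le
  have hS := vw_summable a ha hpos hsum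
  refine ⟨hS, ?_⟩
  set A : ℕ → ℝ := fun j => ∑' k : ℕ, (2 : ℝ) ^ k * a (2 ^ k * (j + 1) - 1) with hA
  have hA0 : ∀ j, 0 ≤ A j := fun j =>
    tsum_nonneg fun k => mul_nonneg (by positivity) (hpos _).le
  have hrec : ∀ j, A j = a j + 2 * A (2 * j + 1) := by
    intro j
    simp only [hA]
    rw [(hS j).tsum_eq_zero_add]
    simp_rw [vw_shift]
    rw [tsum_mul_left]
    simp
  have hR : ∀ M, ∑ j ∈ Finset.Ico M (2 * M), A j ≤ ∑' i, a (i + M) := by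
    intro M
    simp only [hA]
    rw [← Summable.tsum_finsetSum (fun j _ => hS j)]
    exact (summable_sum fun j _ => hS j).tsum_le_of_sum_range_le (vw_tail a ha hpos hsum M)
  have hR0 : Filter.Tendsto (fun M => ∑ j ∈ Finset.Ico M (2 * M), A j) Filter.atTop (nhds 0) :=
    squeeze_zero (fun M => Finset.sum_nonneg fun j _ => hA0 j) hR (tendsto_sum_nat_add a)
  have hE : ∀ M, ∑ j ∈ Finset.range (2 * M), (-1 : ℝ) ^ j * A j =
      ∑ j ∈ Finset.range M, a j + ∑ j ∈ Finset.Ico M (2 * M), A j := by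
    intro M
    rw [Finset.sum_Ico_eq_sub _ (by omega : M ≤ 2 * M)]
    induction M with
    | zero => simp
    | succ M ih =>
      have e : 2 * (M + 1) = 2 * M + 1 + 1 := by ring
      rw [e]
      simp only [Finset.sum_range_succ]
      rw [ih, hrec M]
      simp only [pow_succ, pow_mul]
      norm_num
      ring
  have hEt : Filter.Tendsto (fun M => ∑ j ∈ Finset.range (2 * M), (-1 : ℝ) ^ j * A j)
      Filter.atTop (nhds (∑' k, a k)) := by
    simp_rw [hE]
    simpa using hsum.hasSum.tendsto_sum_nat.add hR0
  have hAt : Filter.Tendsto A Filter.atTop (nhds 0) := by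
    rw [← Filter.tendsto_add_atTop_iff_nat 1]
    refine squeeze_zero (fun j => hA0 _) (fun j => ?_)
      ((Filter.tendsto_add_atTop_iff_nat 1).2 hR0)
    exact Finset.single_le_sum (f := A) (fun i _ => hA0 i)
      (Finset.mem_Ico.2 ⟨le_rfl, by omega⟩)
  have hdiv : Filter.Tendsto (fun N : ℕ => N / 2) Filter.atTop Filter.atTop :=
    Filter.tendsto_atTop_atTop.2 fun b => ⟨2 * b, fun n hn => by omega⟩
  have hdiff : Filter.Tendsto (fun N : ℕ => ∑ j ∈ Finset.range N, (-1 : ℝ) ^ j * A j -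
      ∑ j ∈ Finset.range (2 * (N / 2)), (-1 : ℝ) ^ j * A j) Filter.atTop (nhds 0) := by
    refine squeeze_zero_norm (fun N => ?_)
      (hAt.comp ((Filter.tendsto_sub_atTop_nat 1)))
    rcases Nat.mod_two_eq_zero_or_one N with h | h
    · have e : 2 * (N / 2) = N := by omega
      rw [e, sub_self, norm_zero]
      exact hA0 _
    · obtain ⟨M, rfl⟩ : ∃ M, N = 2 * M + 1 := ⟨N / 2, by omega⟩
      have e : 2 * ((2 * M + 1) / 2) = 2 * M := by omega
      rw [e, Finset.sum_range_succ, add_sub_cancel_left]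
      simp [abs_of_nonneg (hA0 _)]
  simpa using hdiff.add (hEt.comp hdiv)
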